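/- arXiv:2109.06332 — 8 statements merged into one kernel-verified Lean document; each statement's English description precedes it below -/
import Mathlib

section
/- Let S and A be nonempty finite sets, for each a ∈ A let P_a ∈ ℝ^{S×S} be row-stochastic, let γ ∈ [0,1), ρ a probability distribution on S, r : S×A → [0,1], and g¹,…,g^I : S×A → [-1,1]. Fix φ > 0 and a Slater point λ̂ in the probability simplex Δ(S×A) satisfying ⟨λ̂, gⁱ⟩ ≥ φ for all i ∈ [I] and Σ_a (I − γP_aᵀ)λ̂_a = (1−γ)ρ. Let 0 ≤ κ ≤ φ/2 and let λ* be a maximizer of ⟨λ, r⟩ over λ ∈ Δ(S×A) with ⟨λ, gⁱ⟩ ≥ 0 for all i and Σ_a (I − γP_aᵀ)λ_a = (1−γ)ρ. If u ∈ ℝ^I with u ≥ 0 and v ∈ ℝ^S satisfy L_κ(λ̂, u, v) ≤ ⟨λ*, r⟩, where L_κ(λ,u,v) = ⟨λ,r⟩ + Σᵢ uᵢ(⟨λ,gⁱ⟩ − κ) + (1−γ)⟨ρ,v⟩ + Σ_a ⟨λ_a, (γP_a − I)v⟩, then ‖u‖₁ ≤ 2(⟨λ*, r⟩ − ⟨λ̂,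 r⟩)/φ ≤ 2/φ. -/
open Finset

/-- A measure satisfying the discounted flow equations makes the `v`-part of the Lagrangian
vanish. -/
theorem flow_lagrangian_term_eq_zero {S A : Type*} [Fintype S] [Fintype A]
    {P : A → S → S → ℝ} {γ : ℝ} {ρ : S → ℝ} {lam : S × A → ℝ}
    (hflow : ∀ s, (∑ a, lam (s, a))
        - γ * ∑ a, ∑ s', P a s' s * lam (s', a) = (1 - γ) * ρ s) (v : S → ℝ) :
    (1 - γ) * (∑ s, ρ s * v s)
      + (∑ a, ∑ s, lam (s, a) * (γ * (∑ s', P a s s' * v s') - v s)) = 0 := by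
  have hρ : (1 - γ) * (∑ s, ρ s * v s) = (∑ s, (∑ a, lam (s, a)) * v s)
      - γ * ∑ s, (∑ a, ∑ s', P a s' s * lam (s', a)) * v s := by
    rw [mul_sum, mul_sum, ← sum_sub_distrib]
    refine sum_congr rfl fun s _ => ?_
    rw [← mul_assoc, ← hflow s]
    ring
  have hv : ∑ s, (∑ a, lam (s, a)) * v s = ∑ a, ∑ s, lam (s, a) * v s := by
    simp_rw [sum_mul]
    exact sum_comm
  have hP : ∑ s, (∑ a, ∑ s', P a s' s * lam (s', a)) * v s
      = ∑ a, ∑ s, lam (s, a) * ∑ s', P a s s' * v s' := by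
    simp_rw [sum_mul, mul_sum]
    rw [sum_comm]
    refine sum_congr rfl fun a _ => ?_
    rw [sum_comm]
    exact sum_congr rfl fun s _ => sum_congr rfl fun s' _ => by ring
  rw [hρ, hv, hP, mul_sum, ← sum_sub_distrib, ← sum_add_distrib]
  refine sum_eq_zero fun a _ => ?_
  rw [mul_sum, ← sum_sub_distrib, ← sum_add_distrib]
  exact sum_eq_zero fun s _ => by ring

/-- Lemma 1 (first half): boundedness of the dual variable `u` for the
κ-conservative occupancy-measure LP, under the Slater condition. -/
theorem dual_u_bound
    {S A : Type*} [Fintype S] [Fintype A] [Nonempty S] [Nonempty A]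
    (I : ℕ) (P : A → S → S → ℝ)
    (hPnn : ∀ a s s', 0 ≤ P a s s') (hProw : ∀ a s, ∑ s', P a s s' = 1)
    (γ : ℝ) (hγ0 : 0 ≤ γ) (hγ1 : γ < 1)
    (ρ : S → ℝ) (hρnn : ∀ s, 0 ≤ ρ s) (hρsum : ∑ s, ρ s = 1)
    (r : S × A → ℝ) (hr0 : ∀ p, 0 ≤ r p) (hr1 : ∀ p, r p ≤ 1)
    (g : Fin I → S × A → ℝ) (hg : ∀ i p, |g i p| ≤ 1)
    (φ : ℝ) (hφ : 0 < φ)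
    (lamhat : S × A → ℝ)
    (hlh_nn : ∀ p, 0 ≤ lamhat p) (hlh_sum : ∑ p, lamhat p = 1)
    (hlh_g : ∀ i, φ ≤ ∑ p, lamhat p * g i p)
    (hlh_flow : ∀ s, (∑ a, lamhat (s, a))
        - γ * ∑ a, ∑ s', P a s' s * lamhat (s', a) = (1 - γ) * ρ s)
    (κ : ℝ) (hκ0 : 0 ≤ κ) (hκ : κ ≤ φ / 2)
    (lamstar : S × A → ℝ)
    (hls_nn : ∀ p, 0 ≤ lamstar p) (hls_sum : ∑ p, lamstar p = 1)
    (hls_g : ∀ i, 0 ≤ ∑ p, lamstar p * g i p)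
    (hls_flow : ∀ s, (∑ a, lamstar (s, a))
        - γ * ∑ a, ∑ s', P a s' s * lamstar (s', a) = (1 - γ) * ρ s)
    (hls_opt : ∀ lam : S × A → ℝ, (∀ p, 0 ≤ lam p) → (∑ p, lam p = 1) →
      (∀ i, 0 ≤ ∑ p, lam p * g i p) →
      (∀ s, (∑ a, lam (s, a))
        - γ * ∑ a, ∑ s', P a s' s * lam (s', a) = (1 - γ) * ρ s) →
      (∑ p, lam p * r p) ≤ ∑ p, lamstar p * r p)
    (u : Fin I → ℝ) (hu : ∀ i, 0 ≤ u i) (v : S → ℝ)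
    (hL : (∑ p, lamhat p * r p)
        + (∑ i, u i * ((∑ p, lamhat p * g i p) - κ))
        + (1 - γ) * (∑ s, ρ s * v s)
        + (∑ a, ∑ s, lamhat (s, a) * (γ * (∑ s', P a s s' * v s') - v s))
        ≤ ∑ p, lamstar p * r p) :
    (∑ i, |u i|) ≤ 2 * ((∑ p, lamstar p * r p) - (∑ p, lamhat p * r p)) / φ ∧
    2 * ((∑ p, lamstar p * r p) - (∑ p, lamhat p * r p)) / φ ≤ 2 / φ := by
  have hzero := flow_lagrangian_term_eq_zero hlh_flow v
  have hslack : (∑ i, |u i|) * (φ / 2) ≤ ∑ i, u i * ((∑ p, lamhat p * g i p) - κ) := by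
    rw [sum_mul]
    refine sum_le_sum fun i _ => ?_
    rw [abs_of_nonneg (hu i)]
    exact mul_le_mul_of_nonneg_left (by linarith [hlh_g i]) (hu i)
  have hstar : ∑ p, lamstar p * r p ≤ 1 := by
    rw [← hls_sum]
    exact sum_le_sum fun p _ => mul_le_of_le_one_right (hls_nn p) (hr1 p)
  have hhat : 0 ≤ ∑ p, lamhat p * r p :=
    sum_nonneg fun p _ => mul_nonneg (hlh_nn p) (hr0 p)
  constructor
  · rw [le_div_iff₀ hφ]
    linarith
  · exact div_le_div_of_nonneg_right (by linarith) hφ.le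
end

section
/- Let S and A be nonempty finite sets, for each a ∈ A let P_a ∈ ℝ^{S×S} be row-stochastic, let γ ∈ [0,1), φ > 0, r : S×A → [0,1], and g¹,…,g^I : S×A → [-1,1]. Suppose u ∈ ℝ^I with ‖u‖₁ ≤ 2/φ and v ∈ ℝ^S satisfy the stationarity (KKT) identity r(s,a) + Σ_{i∈[I]} uᵢ gⁱ(s,a) − v(s) + γ Σ_{s'} P_a(s,s') v(s') = 0 for every (s,a) ∈ S×A. Then ‖v‖_∞ ≤ 1/(1−γ) + 2/((1−γ)φ). -/
open Finset

/-- A weighted average with nonnegative weights of total mass one is bounded in absolute value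
by any common bound on the averaged values. -/
theorem abs_sum_mul_le_of_sum_eq_one {ι : Type*} [Fintype ι] {w f : ι → ℝ} {M : ℝ}
    (hw : ∀ i, 0 ≤ w i) (hw1 : ∑ i, w i = 1) (hf : ∀ i, |f i| ≤ M) :
    |∑ i, w i * f i| ≤ M :=
  calc |∑ i, w i * f i| ≤ ∑ i, |w i * f i| := abs_sum_le_sum_abs _ _
    _ ≤ ∑ i, w i * M := by
      refine sum_le_sum fun i _ => ?_
      rw [abs_mul, abs_of_nonneg (hw i)]
      exact mul_le_mul_of_nonneg_left (hf i) (hw i)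
    _ = M := by rw [← sum_mul, hw1, one_mul]

/-- Pairing with a function bounded by one is bounded by the `ℓ¹` norm. -/
theorem abs_sum_mul_le_sum_abs {ι : Type*} [Fintype ι] {u f : ι → ℝ} (hf : ∀ i, |f i| ≤ 1) :
    |∑ i, u i * f i| ≤ ∑ i, |u i| :=
  (abs_sum_le_sum_abs _ _).trans <| sum_le_sum fun i _ => by
    rw [abs_mul]
    exact mul_le_of_le_one_right (abs_nonneg _) (hf i)

/-- Lemma 1 (second half): boundedness of the dual variable `v` from the
KKT stationarity identity of the κ-conservative occupancy-measure LP. -/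
theorem dual_v_bound
    {S A : Type*} [Fintype S] [Fintype A] [Nonempty S] [Nonempty A]
    (I : ℕ) (P : A → S → S → ℝ)
    (hPnn : ∀ a s s', 0 ≤ P a s s') (hProw : ∀ a s, ∑ s', P a s s' = 1)
    (γ : ℝ) (hγ0 : 0 ≤ γ) (hγ1 : γ < 1)
    (φ : ℝ) (hφ : 0 < φ)
    (r : S × A → ℝ) (hr0 : ∀ p, 0 ≤ r p) (hr1 : ∀ p, r p ≤ 1)
    (g : Fin I → S × A → ℝ) (hg : ∀ i p, |g i p| ≤ 1)
    (u : Fin I → ℝ) (hu : ∑ i, |u i| ≤ 2 / φ)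
    (v : S → ℝ)
    (hKKT : ∀ s a, r (s, a) + (∑ i, u i * g i (s, a)) - v s
        + γ * ∑ s', P a s s' * v s' = 0) :
    ∀ s, |v s| ≤ 1 / (1 - γ) + 2 / ((1 - γ) * φ) := by
  obtain ⟨s₀, hs₀⟩ := Finite.exists_max fun s => |v s|
  obtain ⟨a⟩ := ‹Nonempty A›
  have hPv : |∑ s', P a s₀ s' * v s'| ≤ |v s₀| :=
    abs_sum_mul_le_of_sum_eq_one (hPnn a s₀) (hProw a s₀) hs₀
  have hug : |∑ i, u i * g i (s₀, a)| ≤ 2 / φ :=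
    (abs_sum_mul_le_sum_abs fun i => hg i (s₀, a)).trans hu
  have hr : |r (s₀, a)| ≤ 1 := by
    rw [abs_of_nonneg (hr0 _)]
    exact hr1 _
  have hv : |v s₀| ≤ 1 + 2 / φ + γ * |v s₀| :=
    calc |v s₀| = |r (s₀, a) + ∑ i, u i * g i (s₀, a) + γ * ∑ s', P a s₀ s' * v s'| := by
          congr 1
          linarith [hKKT s₀ a]
      _ ≤ |r (s₀, a)| + |∑ i, u i * g i (s₀, a)| + |γ * ∑ s', P a s₀ s' * v s'| :=
          abs_add_three _ _ _
      _ ≤ 1 + 2 / φ + γ * |v s₀| := by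
          rw [abs_mul, abs_of_nonneg hγ0]
          gcongr
  have hγ : 0 < 1 - γ := sub_pos.mpr hγ1
  intro s
  calc |v s| ≤ |v s₀| := hs₀ s
    _ ≤ (1 + 2 / φ) / (1 - γ) := by
        rw [le_div_iff₀ hγ]
        linarith
    _ = 1 / (1 - γ) + 2 / ((1 - γ) * φ) := by
        rw [add_div, div_div, mul_comm φ]
end

section
/- Let S and A be nonempty finite sets, for each a ∈ A let P_a ∈ ℝ^{S×S} be row-stochastic, γ ∈ [0,1), ρ a probability distribution on S, r : S×A → [0,1], g¹,…,g^I : S×A → [-1,1], and φ > 0. Assume there exists λ̃ ∈ Δ(S×A) with ⟨λ̃, gⁱ⟩ ≥ φ for all i and Σ_a (I − γP_aᵀ)λ̃_a = (1−γ)ρ (Slater condition with margin φ). Let 0 < κ ≤ min{φ/2, 1}. Let λ* be a maximizer of ⟨λ,r⟩ over λ ∈ Δ(S×A) satisfying ⟨λ,gⁱ⟩ ≥ 0 for all i and Σ_a (I − γP_aᵀ)λ_a = (1−γ)ρ, and let λ*_κ be a maximizer of ⟨λ,r⟩ over λ ∈ Δ(S×A) satisfying ⟨λ,gⁱ⟩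 ≥ κ for all i and the same equality constraint. Then ⟨λ*, r⟩ − ⟨λ*_κ, r⟩ ≤ κ/φ. -/
open Finset

/-- Pairing with a convex combination is the convex combination of the pairings. -/
lemma sum_mix_mul {ι : Type*} [Fintype ι] (t : ℝ) (x y f : ι → ℝ) :
    ∑ p, ((1 - t) * x p + t * y p) * f p
      = (1 - t) * ∑ p, x p * f p + t * ∑ p, y p * f p := by
  simp only [mul_sum, ← sum_add_distrib]
  exact sum_congr rfl fun p _ => by ring

/-- Lemma 3: the gap between the optimal values of the original and the
κ-conservative occupancy-measure linear programs is at most κ/φ. -/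
theorem conservative_gap
    {S A : Type*} [Fintype S] [Fintype A] [Nonempty S] [Nonempty A]
    (I : ℕ) (P : A → S → S → ℝ)
    (hPnn : ∀ a s s', 0 ≤ P a s s') (hProw : ∀ a s, ∑ s', P a s s' = 1)
    (γ : ℝ) (hγ0 : 0 ≤ γ) (hγ1 : γ < 1)
    (ρ : S → ℝ) (hρnn : ∀ s, 0 ≤ ρ s) (hρsum : ∑ s, ρ s = 1)
    (r : S × A → ℝ) (hr0 : ∀ p, 0 ≤ r p) (hr1 : ∀ p, r p ≤ 1)
    (g : Fin I → S × A → ℝ) (hg : ∀ i p, |g i p| ≤ 1)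
    (φ : ℝ) (hφ : 0 < φ)
    (lamtil : S × A → ℝ)
    (hlt_nn : ∀ p, 0 ≤ lamtil p) (hlt_sum : ∑ p, lamtil p = 1)
    (hlt_g : ∀ i, φ ≤ ∑ p, lamtil p * g i p)
    (hlt_flow : ∀ s, (∑ a, lamtil (s, a))
        - γ * ∑ a, ∑ s', P a s' s * lamtil (s', a) = (1 - γ) * ρ s)
    (κ : ℝ) (hκ0 : 0 < κ) (hκ1 : κ ≤ φ / 2) (hκ2 : κ ≤ 1)
    (lamstar : S × A → ℝ)
    (hls_nn : ∀ p, 0 ≤ lamstar p) (hls_sum : ∑ p, lamstar p = 1)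
    (hls_g : ∀ i, 0 ≤ ∑ p, lamstar p * g i p)
    (hls_flow : ∀ s, (∑ a, lamstar (s, a))
        - γ * ∑ a, ∑ s', P a s' s * lamstar (s', a) = (1 - γ) * ρ s)
    (hls_opt : ∀ lam : S × A → ℝ, (∀ p, 0 ≤ lam p) → (∑ p, lam p = 1) →
      (∀ i, 0 ≤ ∑ p, lam p * g i p) →
      (∀ s, (∑ a, lam (s, a))
        - γ * ∑ a, ∑ s', P a s' s * lam (s', a) = (1 - γ) * ρ s) →
      (∑ p, lam p * r p) ≤ ∑ p, lamstar p * r p)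
    (lamkap : S × A → ℝ)
    (hlk_nn : ∀ p, 0 ≤ lamkap p) (hlk_sum : ∑ p, lamkap p = 1)
    (hlk_g : ∀ i, κ ≤ ∑ p, lamkap p * g i p)
    (hlk_flow : ∀ s, (∑ a, lamkap (s, a))
        - γ * ∑ a, ∑ s', P a s' s * lamkap (s', a) = (1 - γ) * ρ s)
    (hlk_opt : ∀ lam : S × A → ℝ, (∀ p, 0 ≤ lam p) → (∑ p, lam p = 1) →
      (∀ i, κ ≤ ∑ p, lam p * g i p) →
      (∀ s, (∑ a, lam (s, a))
        - γ * ∑ a, ∑ s', P a s' s * lam (s', a) = (1 - γ) * ρ s) →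
      (∑ p, lam p * r p) ≤ ∑ p, lamkap p * r p) :
    (∑ p, lamstar p * r p) - (∑ p, lamkap p * r p) ≤ κ / φ := by
  set t := κ / φ with ht
  have ht0 : 0 ≤ t := by positivity
  have ht1 : t ≤ 1 := by rw [ht, div_le_one hφ]; linarith
  have htφ : t * φ = κ := div_mul_cancel₀ κ hφ.ne'
  have hmix := hlk_opt (fun p => (1 - t) * lamstar p + t * lamtil p)
    (fun p => add_nonneg (mul_nonneg (by linarith) (hls_nn p)) (mul_nonneg ht0 (hlt_nn p)))
    (by rw [sum_add_distrib, ← mul_sum, ← mul_sum, hls_sum, hlt_sum]; ring)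
    (fun i => by
      rw [sum_mix_mul]
      have h₁ := mul_nonneg (sub_nonneg.2 ht1) (hls_g i)
      have h₂ := mul_le_mul_of_nonneg_left (hlt_g i) ht0
      linarith)
    (fun s => by
      have hP : ∑ a, ∑ s', P a s' s * ((1 - t) * lamstar (s', a) + t * lamtil (s', a))
          = (1 - t) * ∑ a, ∑ s', P a s' s * lamstar (s', a)
            + t * ∑ a, ∑ s', P a s' s * lamtil (s', a) := by
        simp only [mul_sum, ← sum_add_distrib]
        exact sum_congr rfl fun a _ => sum_congr rfl fun s' _ => by ring
      rw [hP, sum_add_distrib, ← mul_sum, ← mul_sum]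
      linear_combination (1 - t) * hls_flow s + t * hlt_flow s)
  rw [sum_mix_mul] at hmix
  have hr_til : 0 ≤ t * ∑ p, lamtil p * r p :=
    mul_nonneg ht0 (sum_nonneg fun p _ => mul_nonneg (hlt_nn p) (hr0 p))
  have hr_star : ∑ p, lamstar p * r p ≤ 1 :=
    hls_sum ▸ sum_le_sum fun p _ => mul_le_of_le_one_right (hls_nn p) (hr1 p)
  have := mul_le_mul_of_nonneg_left hr_star ht0
  linarith
end

section
/- Let J be a nonempty finite set, β > 0, and Δ : J → ℝ with Δ_j ≤ 0 for all j ∈ J. Let λᵗ be an element of the probability simplex Δ(J) with λᵗ_j > 0 for all j, and define λ^{t+1}_j = λᵗ_j exp(βΔ_j) / Σ_{j'∈J} λᵗ_{j'} exp(βΔ_{j'}). Then for every λ ∈ Δ(J): ⟨Δ, λ − λᵗ⟩ ≤ (1/β)[KL(λ‖λᵗ) − KL(λ‖λ^{t+1})] + (β/2) Σ_{j∈J} λᵗ_j Δ_j², where KL(λ‖μ) = Σ_{j∈J} λ_j log(λ_j/μ_j) with the convention 0·log 0 = 0. -/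
open Finset

/-- The second-order Taylor polynomial of `exp` is an upper bound on the nonpositive half-line. -/
lemma Real.exp_le_quadratic_of_nonpos {x : ℝ} (hx : x ≤ 0) :
    Real.exp x ≤ 1 + x + x ^ 2 / 2 := by
  have h := Real.quadratic_le_exp_of_nonneg (neg_nonneg.2 hx)
  have hmul : Real.exp x * Real.exp (-x) = 1 := by rw [← Real.exp_add]; simp
  have hq : 0 < 1 + x + x ^ 2 / 2 := by nlinarith [sq_nonneg (x + 1)]
  refine le_of_mul_le_mul_right ?_ (Real.exp_pos (-x))
  rw [hmul]
  calc (1 : ℝ) ≤ (1 + x + x ^ 2 / 2) * (1 + -x + (-x) ^ 2 / 2) := by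
        nlinarith [sq_nonneg (x ^ 2)]
    _ ≤ _ := mul_le_mul_of_nonneg_left h hq.le

/-- Second-order bound on the log-partition function of a nonpositive `x` under weights `p`. -/
lemma log_sum_mul_exp_le {J : Type*} [Fintype J] {p x : J → ℝ} (hp : ∀ j, 0 ≤ p j)
    (hsum : ∑ j, p j = 1) (hx : ∀ j, x j ≤ 0) (hZ : 0 < ∑ j, p j * Real.exp (x j)) :
    Real.log (∑ j, p j * Real.exp (x j)) ≤ ∑ j, p j * x j + (∑ j, p j * x j ^ 2) / 2 := by
  have hle : ∑ j, p j * Real.exp (x j) ≤ ∑ j, (p j + p j * x j + p j * x j ^ 2 / 2) :=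
    sum_le_sum fun j _ => by
      linarith [mul_le_mul_of_nonneg_left (Real.exp_le_quadratic_of_nonpos (hx j)) (hp j)]
  rw [sum_add_distrib, sum_add_distrib, hsum, ← sum_div] at hle
  linarith [Real.log_le_sub_one_of_pos hZ]

/-- Lemma 4: one-step descent inequality for the KL-mirror (exponentiated
gradient) update with a nonpositive shifted gradient estimate Δ. -/
theorem kl_mirror_step
    {J : Type*} [Fintype J] [Nonempty J]
    (β : ℝ) (hβ : 0 < β) (Δ : J → ℝ) (hΔ : ∀ j, Δ j ≤ 0)
    (lamt : J → ℝ) (hpos : ∀ j, 0 < lamt j) (hsum : ∑ j, lamt j = 1)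
    (lamt1 : J → ℝ)
    (hdef : ∀ j, lamt1 j =
      lamt j * Real.exp (β * Δ j) / ∑ j', lamt j' * Real.exp (β * Δ j'))
    (lam : J → ℝ) (hlnn : ∀ j, 0 ≤ lam j) (hlsum : ∑ j, lam j = 1) :
    (∑ j, Δ j * (lam j - lamt j)) ≤
      (1 / β) * ((∑ j, lam j * Real.log (lam j / lamt j))
        - (∑ j, lam j * Real.log (lam j / lamt1 j)))
      + (β / 2) * ∑ j, lamt j * (Δ j) ^ 2 := by
  have hZ : 0 < ∑ j, lamt j * Real.exp (β * Δ j) :=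
    sum_pos (fun j _ => mul_pos (hpos j) (Real.exp_pos _)) univ_nonempty
  have hlog := log_sum_mul_exp_le (fun j => (hpos j).le) hsum
    (fun j => mul_nonpos_of_nonneg_of_nonpos hβ.le (hΔ j)) hZ
  set Z := ∑ j, lamt j * Real.exp (β * Δ j)
  have hterm : ∀ j, lam j * Real.log (lam j / lamt j) - lam j * Real.log (lam j / lamt1 j)
      = β * (Δ j * lam j) - lam j * Real.log Z := by
    intro j
    rcases (hlnn j).eq_or_lt with h | h
    · simp [← h]
    · have he := Real.exp_pos (β * Δ j)
      have hmul := mul_pos (hpos j) he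
      rw [hdef j, Real.log_div h.ne' (hpos j).ne', Real.log_div h.ne' (div_pos hmul hZ).ne',
        Real.log_div hmul.ne' hZ.ne', Real.log_mul (hpos j).ne' he.ne', Real.log_exp]
      ring
  have hKL : (∑ j, lam j * Real.log (lam j / lamt j)) - ∑ j, lam j * Real.log (lam j / lamt1 j)
      = β * ∑ j, Δ j * lam j - Real.log Z := by
    rw [← sum_sub_distrib, sum_congr rfl fun j _ => hterm j, sum_sub_distrib, ← mul_sum,
      ← sum_mul, hlsum, one_mul]
  have hlin : ∑ j, lamt j * (β * Δ j) = β * ∑ j, Δ j * lamt j := by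
    rw [mul_sum]; exact sum_congr rfl fun j _ => by ring
  have hquad : ∑ j, lamt j * (β * Δ j) ^ 2 = β ^ 2 * ∑ j, lamt j * Δ j ^ 2 := by
    rw [mul_sum]; exact sum_congr rfl fun j _ => by ring
  rw [hlin, hquad] at hlog
  simp only [mul_sub, sum_sub_distrib]
  rw [← mul_sub, hKL]
  refine le_of_mul_le_mul_left ?_ hβ
  have hcancel : β * (1 / β * (β * ∑ j, Δ j * lam j - Real.log Z))
      = β * ∑ j, Δ j * lam j - Real.log Z := by field_simp
  rw [mul_add, hcancel]
  linarith
end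

section
/- Let S and A be nonempty finite sets, for each a ∈ A let P_a ∈ ℝ^{S×S} be row-stochastic, let γ ∈ [0,1), δ ∈ (0,1/2), and let ρ be a probability distribution on S. Then for every λ ∈ Δ(S×A), with ζ(s,a) := (1−δ)λ(s,a) + δ/(|S||A|): Σ_{s₀∈S} ρ(s₀) Σ_{(s,a)∈S×A} ζ(s,a) Σ_{s'∈S} P_a(s,s') · ‖ (1−γ) e_{s₀} + λ(s,a)(γ e_{s'} − e_s)/ζ(s,a) ‖₂² ≤ 3 + 6/(1−δ)², where e_s ∈ ℝ^S is the standard basis vector of s and ‖·‖₂ is the Euclidean norm on ℝ^S. -/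
open Finset

/-- A convex combination of reals bounded above by `C` is bounded above by `C`. -/
lemma sum_mul_le_of_forall_le {ι : Type*} [Fintype ι] {w f : ι → ℝ} {C : ℝ}
    (hw : ∀ i, 0 ≤ w i) (hsum : ∑ i, w i = 1) (hf : ∀ i, f i ≤ C) :
    ∑ i, w i * f i ≤ C :=
  calc ∑ i, w i * f i ≤ ∑ i, w i * C :=
        sum_le_sum fun i _ => mul_le_mul_of_nonneg_left (hf i) (hw i)
    _ = C := by rw [← sum_mul, hsum, one_mul]

/-- The squared Euclidean norm of `a e_i + b e_j - c e_k` is at most `3 (a² + b² + c²)`. -/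
lemma sum_sq_indicator_combination_le {S : Type*} [Fintype S] [DecidableEq S]
    (a b c : ℝ) (i j k : S) :
    ∑ s, (a * (if s = i then (1 : ℝ) else 0) + b * (if s = j then (1 : ℝ) else 0)
        - c * (if s = k then (1 : ℝ) else 0)) ^ 2 ≤ 3 * (a ^ 2 + b ^ 2 + c ^ 2) := by
  have three_sq (x y z : ℝ) : (x + y - z) ^ 2 ≤ 3 * (x ^ 2 + y ^ 2 + z ^ 2) := by
    nlinarith [sq_nonneg (x - y), sq_nonneg (x + z), sq_nonneg (y + z)]
  refine (sum_le_sum fun s _ => three_sq _ _ _).trans_eq ?_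
  simp [← mul_sum, sum_add_distrib]

/-- Deterministic inequality underlying the second-moment bound for the
stochastic gradient with respect to the dual variable `v` (part of E[T₅]). -/
theorem dual_v_second_moment_bound
    {S A : Type*} [Fintype S] [Fintype A] [Nonempty S] [Nonempty A]
    [DecidableEq S]
    (P : A → S → S → ℝ)
    (hPnn : ∀ a s s', 0 ≤ P a s s') (hProw : ∀ a s, ∑ s', P a s s' = 1)
    (γ : ℝ) (hγ0 : 0 ≤ γ) (hγ1 : γ < 1)
    (δ : ℝ) (hδ0 : 0 < δ) (hδ1 : δ < 1 / 2)
    (ρ : S → ℝ) (hρnn : ∀ s, 0 ≤ ρ s) (hρsum : ∑ s, ρ s = 1)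
    (lam : S × A → ℝ) (hlnn : ∀ p, 0 ≤ lam p) (hlsum : ∑ p, lam p = 1)
    (ζ : S × A → ℝ)
    (hζ : ∀ p, ζ p = (1 - δ) * lam p
        + δ / ((Fintype.card S : ℝ) * (Fintype.card A : ℝ))) :
    (∑ s₀, ρ s₀ * ∑ p : S × A, ζ p * ∑ s', P p.2 p.1 s' *
        ∑ s'', ((1 - γ) * (if s'' = s₀ then (1 : ℝ) else 0)
          + lam p * (γ * (if s'' = s' then (1 : ℝ) else 0)
              - (if s'' = p.1 then (1 : ℝ) else 0)) / ζ p) ^ 2)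
      ≤ 3 + 6 / (1 - δ) ^ 2 := by
  have hcard : (0 : ℝ) < (Fintype.card S : ℝ) * (Fintype.card A : ℝ) := by
    have := Fintype.card_pos (α := S)
    have := Fintype.card_pos (α := A)
    positivity
  have hδ : 0 < 1 - δ := by linarith
  have hζpos (p) : 0 < ζ p := by
    rw [hζ]
    have := mul_nonneg hδ.le (hlnn p)
    positivity
  have hζsum : ∑ p, ζ p = 1 := by
    simp only [hζ, sum_add_distrib, ← mul_sum, hlsum, sum_const, card_univ, Fintype.card_prod,
      nsmul_eq_mul, Nat.cast_mul]
    rw [mul_div_cancel₀ _ hcard.ne']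
    ring
  refine sum_mul_le_of_forall_le hρnn hρsum fun s₀ =>
    sum_mul_le_of_forall_le (fun p => (hζpos p).le) hζsum fun p =>
    sum_mul_le_of_forall_le (hPnn _ _) (hProw _ _) fun s' => ?_
  have hratio_nonneg : 0 ≤ lam p / ζ p := div_nonneg (hlnn p) (hζpos p).le
  have hratio_le : lam p / ζ p ≤ 1 / (1 - δ) := by
    rw [div_le_div_iff₀ (hζpos p) hδ, hζ]
    have : 0 < δ / ((Fintype.card S : ℝ) * (Fintype.card A : ℝ)) := by positivity
    linarith
  have hratio_sq : (lam p / ζ p) ^ 2 ≤ 1 / (1 - δ) ^ 2 := by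
    simpa [div_pow] using pow_le_pow_left₀ hratio_nonneg hratio_le 2
  have hγ_sq : γ ^ 2 ≤ 1 := pow_le_one₀ hγ0 hγ1.le
  have hγ_sq' : (1 - γ) ^ 2 ≤ 1 := pow_le_one₀ (by linarith) (by linarith)
  calc _ = ∑ s'', ((1 - γ) * (if s'' = s₀ then (1 : ℝ) else 0)
          + lam p / ζ p * γ * (if s'' = s' then (1 : ℝ) else 0)
          - lam p / ζ p * (if s'' = p.1 then (1 : ℝ) else 0)) ^ 2 :=
        sum_congr rfl fun s'' _ => by ring
    _ ≤ 3 * ((1 - γ) ^ 2 + (lam p / ζ p * γ) ^ 2 + (lam p / ζ p) ^ 2) :=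
        sum_sq_indicator_combination_le _ _ _ _ _ _
    _ ≤ 3 * (1 + 1 / (1 - δ) ^ 2 + 1 / (1 - δ) ^ 2) := by
        have : (lam p / ζ p * γ) ^ 2 ≤ (lam p / ζ p) ^ 2 := by
          rw [mul_pow]
          exact mul_le_of_le_one_right (sq_nonneg _) hγ_sq
        linarith
    _ = 3 + 6 / (1 - δ) ^ 2 := by ring
end

section
/- Let S and A be nonempty finite sets, for each a ∈ A let P_a ∈ ℝ^{S×S} be row-stochastic, γ ∈ [0,1), ρ a probability distribution on S, and r : S×A → ℝ with ‖r‖_∞ ≤ 1. Let λ̄ ∈ Δ(S×A) be such that m(s) := Σ_{a'} λ̄(s,a') > 0 for every s ∈ S, and define the induced policy π̄(a|s) = λ̄(s,a)/m(s), the initial state–action distribution ρ̃(s,a) = ρ(s)·π̄(a|s), and the induced transition matrix P_π̄ ∈ ℝ^{(S×A)×(S×A)} by P_π̄((s,a),(s',a')) = P_a(s,s')·π̄(a'|s'). If ‖Σ_a (γP_aᵀ − I)λ̄_a + (1−γ)ρ‖₁ ≤ (1−γ)c for some c ≥ 0, then | ⟨λ̄, r⟩ − (1−γ) Σ_{t=0}^∞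 γᵗ ⟨(P_π̄ᵀ)ᵗ ρ̃, r⟩ | ≤ c; in particular the series converges absolutely. -/
open Finset

/-- Powers of the transpose of a row-stochastic matrix do not increase the `ℓ₁` norm. -/
lemma sum_abs_transpose_pow_mulVec_le {ι : Type*} [Fintype ι] [DecidableEq ι]
    {M : Matrix ι ι ℝ} (hM : ∀ i j, 0 ≤ M i j) (hrow : ∀ i, ∑ j, M i j = 1)
    (x : ι → ℝ) (t : ℕ) :
    ∑ i, |(M.transpose ^ t).mulVec x i| ≤ ∑ i, |x i| := by
  induction t with
  | zero => simp
  | succ t ih =>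
    refine le_trans ?_ ih
    rw [pow_succ', ← Matrix.mulVec_mulVec]
    set y := (M.transpose ^ t).mulVec x
    calc ∑ i, |M.transpose.mulVec y i|
        ≤ ∑ i, ∑ j, M j i * |y j| := by
          refine sum_le_sum fun i _ => (abs_sum_le_sum_abs _ _).trans_eq ?_
          refine sum_congr rfl fun j _ => ?_
          simp only [Matrix.transpose_apply, abs_mul, abs_of_nonneg (hM j i)]
      _ = ∑ j, |y j| := by
          rw [sum_comm]
          simp [← sum_mul, hrow]

/-- The discounted terms `γ ^ t ⟨(Mᵀ) ^ t x, r⟩` are dominated by a geometric sequence. -/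
lemma abs_discounted_term_le {ι : Type*} [Fintype ι] [DecidableEq ι]
    {M : Matrix ι ι ℝ} (hM : ∀ i j, 0 ≤ M i j) (hrow : ∀ i, ∑ j, M i j = 1)
    {γ : ℝ} (hγ0 : 0 ≤ γ) {r : ι → ℝ} (hr : ∀ i, |r i| ≤ 1) (x : ι → ℝ) (t : ℕ) :
    |γ ^ t * ∑ i, (M.transpose ^ t).mulVec x i * r i| ≤ γ ^ t * ∑ i, |x i| := by
  rw [abs_mul, abs_of_nonneg (pow_nonneg hγ0 t)]
  refine mul_le_mul_of_nonneg_left ?_ (pow_nonneg hγ0 t)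
  refine (abs_sum_le_sum_abs _ _).trans
    (le_trans (sum_le_sum fun i _ => ?_) (sum_abs_transpose_pow_mulVec_le hM hrow x t))
  rw [abs_mul]
  exact mul_le_of_le_one_right (abs_nonneg _) (hr i)

lemma summable_abs_discounted_term {ι : Type*} [Fintype ι] [DecidableEq ι]
    {M : Matrix ι ι ℝ} (hM : ∀ i j, 0 ≤ M i j) (hrow : ∀ i, ∑ j, M i j = 1)
    {γ : ℝ} (hγ0 : 0 ≤ γ) (hγ1 : γ < 1) {r : ι → ℝ} (hr : ∀ i, |r i| ≤ 1) (x : ι → ℝ) :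
    Summable fun t : ℕ => |γ ^ t * ∑ i, (M.transpose ^ t).mulVec x i * r i| :=
  Summable.of_nonneg_of_le (fun _ => abs_nonneg _) (abs_discounted_term_le hM hrow hγ0 hr x)
    ((summable_geometric_of_lt_one hγ0 hγ1).mul_right _)

/-- If `x` satisfies the flow equation `x = γ Mᵀ x + (1 - γ) y` up to an `ℓ₁` error `(1 - γ) c`,
then `⟨x, r⟩` is within `c` of the normalized discounted value started from `y`. -/
lemma abs_sub_discounted_value_le {ι : Type*} [Fintype ι] [DecidableEq ι]
    {M : Matrix ι ι ℝ} (hM : ∀ i j, 0 ≤ M i j) (hrow : ∀ i, ∑ j, M i j = 1)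
    {γ : ℝ} (hγ0 : 0 ≤ γ) (hγ1 : γ < 1) {r : ι → ℝ} (hr : ∀ i, |r i| ≤ 1)
    (x y : ι → ℝ) {c : ℝ}
    (hres : ∑ i, |(γ • M.transpose.mulVec x - x + (1 - γ) • y) i| ≤ (1 - γ) * c) :
    |(∑ i, x i * r i)
        - (1 - γ) * ∑' t : ℕ, γ ^ t * ∑ i, (M.transpose ^ t).mulVec y i * r i| ≤ c := by
  set e : ι → ℝ := γ • M.transpose.mulVec x - x + (1 - γ) • y with he
  let f : (ι → ℝ) → ℕ → ℝ := fun z t => γ ^ t * ∑ i, (M.transpose ^ t).mulVec z i * r i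
  have hf (z : ι → ℝ) : Summable (f z) :=
    (summable_abs_discounted_term hM hrow hγ0 hγ1 hr z).of_abs
  have hstep (t : ℕ) : f e t = f x (t + 1) - f x t + (1 - γ) * f y t := by
    simp only [f, he, Matrix.mulVec_add, Matrix.mulVec_sub, Matrix.mulVec_smul,
      Matrix.mulVec_mulVec, ← pow_succ, Pi.add_apply, Pi.sub_apply, Pi.smul_apply, smul_eq_mul,
      add_mul, sub_mul, sum_add_distrib, sum_sub_distrib, mul_assoc, ← mul_sum]
    ring
  have hsum : ∑' t, f e t = -(∑ i, x i * r i) + (1 - γ) * ∑' t, f y t := by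
    have hshift : Summable fun t => f x (t + 1) := (summable_nat_add_iff 1).2 (hf x)
    have hzero : f x 0 = ∑ i, x i * r i := by simp [f]
    rw [tsum_congr hstep, (hshift.sub (hf x)).tsum_add ((hf y).mul_left _),
      hshift.tsum_sub (hf x), tsum_mul_left, (hf x).tsum_eq_zero_add, hzero]
    ring
  have hbound : |∑' t, f e t| ≤ (1 - γ)⁻¹ * ∑ i, |e i| := by
    rw [← Real.norm_eq_abs]
    exact tsum_of_norm_bounded ((hasSum_geometric_of_lt_one hγ0 hγ1).mul_right _)
      (abs_discounted_term_le hM hrow hγ0 hr e)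
  have hpos : 0 < 1 - γ := sub_pos.2 hγ1
  calc |(∑ i, x i * r i) - (1 - γ) * ∑' t, f y t|
      = |∑' t, f e t| := by rw [hsum, ← abs_neg]; congr 1; ring
    _ ≤ (1 - γ)⁻¹ * ((1 - γ) * c) :=
        hbound.trans (mul_le_mul_of_nonneg_left hres (inv_nonneg.2 hpos.le))
    _ = c := inv_mul_cancel_left₀ hpos.ne' c

/-- Key deterministic step of Theorem 3: the discounted value of the policy
induced by an occupancy measure λ̄ is within `c` of the occupancy-measure
objective whenever the flow-constraint residual of λ̄ is at most `(1-γ)c`. -/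
theorem induced_policy_value_close
    {S A : Type*} [Fintype S] [Fintype A] [Nonempty S] [Nonempty A]
    [DecidableEq S] [DecidableEq A]
    (P : A → S → S → ℝ)
    (hPnn : ∀ a s s', 0 ≤ P a s s') (hProw : ∀ a s, ∑ s', P a s s' = 1)
    (γ : ℝ) (hγ0 : 0 ≤ γ) (hγ1 : γ < 1)
    (ρ : S → ℝ) (hρnn : ∀ s, 0 ≤ ρ s) (hρsum : ∑ s, ρ s = 1)
    (r : S × A → ℝ) (hr : ∀ p, |r p| ≤ 1)
    (lambar : S × A → ℝ)
    (hlnn : ∀ p, 0 ≤ lambar p) (hlsum : ∑ p, lambar p = 1)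
    (m : S → ℝ) (hm : ∀ s, m s = ∑ a, lambar (s, a)) (hmpos : ∀ s, 0 < m s)
    (pibar : S → A → ℝ) (hpibar : ∀ s a, pibar s a = lambar (s, a) / m s)
    (ρt : S × A → ℝ) (hρt : ∀ p, ρt p = ρ p.1 * pibar p.1 p.2)
    (Ppi : Matrix (S × A) (S × A) ℝ)
    (hPpi : ∀ p q, Ppi p q = P p.2 p.1 q.1 * pibar q.1 q.2)
    (c : ℝ) (hc : 0 ≤ c)
    (hres : (∑ s,
        |(∑ a, (γ * (∑ s', P a s' s * lambar (s', a)) - lambar (s, a)))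
          + (1 - γ) * ρ s|) ≤ (1 - γ) * c) :
    Summable (fun t : ℕ =>
      |γ ^ t * ∑ p, (Ppi.transpose ^ t).mulVec ρt p * r p|) ∧
    |(∑ p, lambar p * r p)
        - (1 - γ) * ∑' t : ℕ, γ ^ t * ∑ p, (Ppi.transpose ^ t).mulVec ρt p * r p|
      ≤ c := by
  have hpi_nonneg (s : S) (a : A) : 0 ≤ pibar s a := by
    rw [hpibar]
    exact div_nonneg (hlnn _) (hmpos s).le
  have hpi_sum (s : S) : ∑ a, pibar s a = 1 := by
    simp only [hpibar, ← sum_div, ← hm]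
    exact div_self (hmpos s).ne'
  have hM (p q : S × A) : 0 ≤ Ppi p q := by
    rw [hPpi]
    exact mul_nonneg (hPnn _ _ _) (hpi_nonneg _ _)
  have hrow (p : S × A) : ∑ q, Ppi p q = 1 := by
    simp only [hPpi, Fintype.sum_prod_type, ← mul_sum, hpi_sum, mul_one, hProw]
  refine ⟨summable_abs_discounted_term hM hrow hγ0 hγ1 hr ρt,
    abs_sub_discounted_value_le hM hrow hγ0 hγ1 hr lambar ρt (le_of_eq_of_le ?_ hres)⟩
  rw [Fintype.sum_prod_type]
  refine sum_congr rfl fun s _ => ?_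
  have hresidual (a : A) :
      (γ • Ppi.transpose.mulVec lambar - lambar + (1 - γ) • ρt) (s, a)
        = ((∑ a, (γ * (∑ s', P a s' s * lambar (s', a)) - lambar (s, a))) + (1 - γ) * ρ s)
          * pibar s a := by
    have hflow : Ppi.transpose.mulVec lambar (s, a)
        = (∑ a', ∑ s', P a' s' s * lambar (s', a')) * pibar s a := by
      simp only [Matrix.mulVec, dotProduct, Matrix.transpose_apply, hPpi,
        Fintype.sum_prod_type_right, sum_mul]
      exact sum_congr rfl fun _ _ => sum_congr rfl fun _ _ => by ring
    have hlam : lambar (s, a) = m s * pibar s a := by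
      rw [hpibar, mul_div_cancel₀ _ (hmpos s).ne']
    simp only [Pi.add_apply, Pi.sub_apply, Pi.smul_apply, smul_eq_mul, hflow, hρt,
      sum_sub_distrib, ← mul_sum, ← hm]
    rw [hlam]
    ring
  simp only [hresidual, abs_mul, abs_of_nonneg (hpi_nonneg _ _), ← mul_sum, hpi_sum, mul_one]
end

section
/- Let S and A be nonempty finite sets, for each a ∈ A let P_a ∈ ℝ^{S×S} be row-stochastic, γ ∈ [0,1), ρ a probability distribution on S, and g : S×A → ℝ with ‖g‖_∞ ≤ 1. Let λ̄ ∈ Δ(S×A) with m(s) := Σ_{a'} λ̄(s,a') > 0 for every s ∈ S, and define π̄(a|s) = λ̄(s,a)/m(s), ρ̃(s,a) = ρ(s)·π̄(a|s), and P_π̄((s,a),(s',a')) = P_a(s,s')·π̄(a'|s'). Suppose for some c ≥ 0 that ‖Σ_a (γP_aᵀ − I)λ̄_a + (1−γ)ρ‖₁ ≤ (1−γ)c and ⟨λ̄, g⟩ ≥ c. Then (1−γ) Σ_{t=0}^∞ γᵗ ⟨(P_π̄ᵀ)ᵗ ρ̃, g⟩ ≥ 0; that is, the induced policy π̄ has nonnegative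 discounted constraint value (zero constraint violation). -/
open Finset

section Stochastic

open Matrix

variable {n : Type*} [Fintype n] [DecidableEq n]

/-- Transposes of row-stochastic matrices are nonexpansive in the `ℓ¹` norm, paired here with a
test vector of sup norm at most one. -/
lemma abs_sum_transpose_mulVec_mul_le {Q : Matrix n n ℝ} (hQ : Q ∈ rowStochastic ℝ n)
    {g : n → ℝ} (hg : ∀ i, |g i| ≤ 1) (v : n → ℝ) :
    |∑ i, (Qᵀ *ᵥ v) i * g i| ≤ ∑ j, |v j| := by
  have hswap : ∑ i, (Qᵀ *ᵥ v) i * g i = ∑ j, v j * ∑ i, Q j i * g i := by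
    simp only [mulVec, dotProduct, transpose_apply, sum_mul, mul_sum]
    rw [sum_comm]
    exact sum_congr rfl fun _ _ => sum_congr rfl fun _ _ => by ring
  rw [hswap]
  refine (abs_sum_le_sum_abs _ _).trans (sum_le_sum fun j _ => ?_)
  rw [abs_mul]
  refine mul_le_of_le_one_right (abs_nonneg _) ((abs_sum_le_sum_abs _ _).trans ?_)
  rw [← sum_row_of_mem_rowStochastic hQ j]
  refine sum_le_sum fun i _ => ?_
  rw [abs_mul, abs_of_nonneg (nonneg_of_mem_rowStochastic hQ)]
  exact mul_le_of_le_one_right (nonneg_of_mem_rowStochastic hQ) (hg i)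

lemma abs_sum_transpose_pow_mulVec_mul_le {Q : Matrix n n ℝ} (hQ : Q ∈ rowStochastic ℝ n)
    {g : n → ℝ} (hg : ∀ i, |g i| ≤ 1) (v : n → ℝ) (t : ℕ) :
    |∑ i, (Qᵀ ^ t *ᵥ v) i * g i| ≤ ∑ j, |v j| := by
  rw [← transpose_pow]
  exact abs_sum_transpose_mulVec_mul_le (pow_mem hQ t) hg v

/-- Telescoping of the discounted flow equation `(1 - γ) r = e + l - γ M l`. -/
lemma discounted_sum_eq_of_flow {M : Matrix n n ℝ} {γ : ℝ} {r e l : n → ℝ} (g : n → ℝ)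
    (hflow : (1 - γ) • r = e + l - γ • (M *ᵥ l)) (N : ℕ) :
    (1 - γ) * ∑ t ∈ range N, γ ^ t * ∑ i, (M ^ t *ᵥ r) i * g i =
      ∑ t ∈ range N, γ ^ t * ∑ i, (M ^ t *ᵥ e) i * g i
        + ∑ i, l i * g i - γ ^ N * ∑ i, (M ^ N *ᵥ l) i * g i := by
  induction N with
  | zero => simp
  | succ N ih =>
    have hstep : (1 - γ) * ∑ i, (M ^ N *ᵥ r) i * g i =
        ∑ i, (M ^ N *ᵥ e) i * g i + ∑ i, (M ^ N *ᵥ l) i * g i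
          - γ * ∑ i, (M ^ (N + 1) *ᵥ l) i * g i := by
      have h := congrArg (fun v => (M ^ N *ᵥ v) ⬝ᵥ g) hflow
      simp only [mulVec_sub, mulVec_add, mulVec_smul, mulVec_mulVec, ← pow_succ, sub_dotProduct,
        add_dotProduct, smul_dotProduct, smul_eq_mul] at h
      exact h
    rw [sum_range_succ, sum_range_succ, mul_add, ih]
    linear_combination γ ^ N * hstep

/-- If `l` satisfies the discounted flow equation up to an `ℓ¹` error `(1 - γ) c` and has
`⟨l, g⟩ ≥ c`, then the discounted value of `g` is nonnegative. -/
lemma discounted_value_nonneg_of_flow {Q : Matrix n n ℝ} (hQ : Q ∈ rowStochastic ℝ n)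
    {γ c : ℝ} (hγ0 : 0 ≤ γ) (hγ1 : γ < 1) (hc : 0 ≤ c) {r e l g : n → ℝ}
    (hg : ∀ i, |g i| ≤ 1) (hflow : (1 - γ) • r = e + l - γ • (Qᵀ *ᵥ l))
    (he : ∑ i, |e i| ≤ (1 - γ) * c) (hmargin : c ≤ ∑ i, l i * g i) :
    0 ≤ (1 - γ) * ∑' t : ℕ, γ ^ t * ∑ i, (Qᵀ ^ t *ᵥ r) i * g i := by
  have hsummable : Summable fun t : ℕ => γ ^ t * ∑ i, (Qᵀ ^ t *ᵥ r) i * g i := by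
    refine Summable.of_norm_bounded
      ((summable_geometric_of_lt_one hγ0 hγ1).mul_right (∑ i, |r i|)) fun t => ?_
    rw [Real.norm_eq_abs, abs_mul, abs_of_nonneg (pow_nonneg hγ0 t)]
    exact mul_le_mul_of_nonneg_left (abs_sum_transpose_pow_mulVec_mul_le hQ hg r t)
      (pow_nonneg hγ0 t)
  have hlower : ∀ N : ℕ, -(γ ^ N * ∑ i, |l i|) ≤
      (1 - γ) * ∑ t ∈ range N, γ ^ t * ∑ i, (Qᵀ ^ t *ᵥ r) i * g i := by
    intro N
    rw [discounted_sum_eq_of_flow g hflow]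
    have herr : ∑ t ∈ range N, γ ^ t * -((1 - γ) * c) ≤
        ∑ t ∈ range N, γ ^ t * ∑ i, (Qᵀ ^ t *ᵥ e) i * g i :=
      sum_le_sum fun t _ => mul_le_mul_of_nonneg_left
        (abs_le.mp ((abs_sum_transpose_pow_mulVec_mul_le hQ hg e t).trans he)).1
        (pow_nonneg hγ0 t)
    have hgeom : ∑ t ∈ range N, γ ^ t * -((1 - γ) * c) = -(c * (1 - γ ^ N)) := by
      rw [← sum_mul]
      linear_combination (-c) * geom_sum_mul_neg γ N
    have htail : γ ^ N * ∑ i, (Qᵀ ^ N *ᵥ l) i * g i ≤ γ ^ N * ∑ i, |l i| :=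
      mul_le_mul_of_nonneg_left
        (abs_le.mp (abs_sum_transpose_pow_mulVec_mul_le hQ hg l N)).2 (pow_nonneg hγ0 N)
    have hcγ : 0 ≤ c * γ ^ N := mul_nonneg hc (pow_nonneg hγ0 N)
    linarith
  have hzero : Filter.Tendsto (fun N : ℕ => -(γ ^ N * ∑ i, |l i|)) Filter.atTop (nhds 0) := by
    simpa using ((tendsto_pow_atTop_nhds_zero_of_lt_one hγ0 hγ1).mul_const (∑ i, |l i|)).neg
  exact le_of_tendsto_of_tendsto' hzero
    (hsummable.hasSum.tendsto_sum_nat.const_mul (1 - γ)) hlower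

end Stochastic

/-- Zero-constraint-violation conclusion of Theorem 3 (deterministic form):
a constraint margin of `c` in occupancy-measure space compensates the
conversion error incurred when passing to the induced policy. -/
theorem induced_policy_zero_violation
    {S A : Type*} [Fintype S] [Fintype A] [Nonempty S] [Nonempty A]
    [DecidableEq S] [DecidableEq A]
    (P : A → S → S → ℝ)
    (hPnn : ∀ a s s', 0 ≤ P a s s') (hProw : ∀ a s, ∑ s', P a s s' = 1)
    (γ : ℝ) (hγ0 : 0 ≤ γ) (hγ1 : γ < 1)
    (ρ : S → ℝ) (hρnn : ∀ s, 0 ≤ ρ s) (hρsum : ∑ s, ρ s = 1)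
    (g : S × A → ℝ) (hgbd : ∀ p, |g p| ≤ 1)
    (lambar : S × A → ℝ)
    (hlnn : ∀ p, 0 ≤ lambar p) (hlsum : ∑ p, lambar p = 1)
    (m : S → ℝ) (hm : ∀ s, m s = ∑ a, lambar (s, a)) (hmpos : ∀ s, 0 < m s)
    (pibar : S → A → ℝ) (hpibar : ∀ s a, pibar s a = lambar (s, a) / m s)
    (ρt : S × A → ℝ) (hρt : ∀ p, ρt p = ρ p.1 * pibar p.1 p.2)
    (Ppi : Matrix (S × A) (S × A) ℝ)
    (hPpi : ∀ p q, Ppi p q = P p.2 p.1 q.1 * pibar q.1 q.2)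
    (c : ℝ) (hc : 0 ≤ c)
    (hres : (∑ s,
        |(∑ a, (γ * (∑ s', P a s' s * lambar (s', a)) - lambar (s, a)))
          + (1 - γ) * ρ s|) ≤ (1 - γ) * c)
    (hmargin : c ≤ ∑ p, lambar p * g p) :
    0 ≤ (1 - γ) * ∑' t : ℕ, γ ^ t * ∑ p, (Ppi.transpose ^ t).mulVec ρt p * g p := by
  have hpinn : ∀ s a, 0 ≤ pibar s a := fun s a => by
    rw [hpibar]
    exact div_nonneg (hlnn _) (hmpos s).le
  have hpisum : ∀ s, ∑ a, pibar s a = 1 := fun s => by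
    simp only [hpibar]
    rw [← sum_div, ← hm, div_self (hmpos s).ne']
  have hlam : ∀ s a, lambar (s, a) = m s * pibar s a := fun s a => by
    rw [hpibar, mul_div_cancel₀ _ (hmpos s).ne']
  have hQ : Ppi ∈ Matrix.rowStochastic ℝ (S × A) := by
    rw [Matrix.mem_rowStochastic_iff_sum]
    refine ⟨fun p q => ?_, fun p => ?_⟩
    · rw [hPpi]
      exact mul_nonneg (hPnn _ _ _) (hpinn _ _)
    · simp only [hPpi, Fintype.sum_prod_type, ← mul_sum, hpisum, mul_one, hProw]
  set d : S → ℝ := fun s =>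
    (∑ a, (γ * (∑ s', P a s' s * lambar (s', a)) - lambar (s, a))) + (1 - γ) * ρ s with hd
  refine discounted_value_nonneg_of_flow (e := fun p => d p.1 * pibar p.1 p.2) (l := lambar)
    hQ hγ0 hγ1 hc hgbd ?_ ?_ hmargin
  · funext ⟨s, a⟩
    have hM : (Ppi.transpose.mulVec lambar) (s, a) =
        (∑ a', ∑ s', P a' s' s * lambar (s', a')) * pibar s a := by
      simp only [Matrix.mulVec, dotProduct, Matrix.transpose_apply, hPpi, Fintype.sum_prod_type,
        sum_mul]
      rw [sum_comm]
      exact sum_congr rfl fun _ _ => sum_congr rfl fun _ _ => by ring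
    simp only [Pi.smul_apply, Pi.add_apply, Pi.sub_apply, smul_eq_mul, hM, hρt, hd,
      sum_sub_distrib, ← mul_sum, ← hm]
    rw [hlam s a]
    ring
  · refine le_trans (le_of_eq ?_) hres
    simp only [Fintype.sum_prod_type, abs_mul, abs_of_nonneg (hpinn _ _), ← mul_sum, hpisum,
      mul_one, hd]
end

section
/- Let S and A be nonempty finite sets, for each a ∈ A let P_a ∈ ℝ^{S×S} be row-stochastic, γ ∈ [0,1), and ρ a probability distribution on S. Let π be a stationary policy, i.e., π(·|s) is a probability distribution on A for each s ∈ S. Define ρ̃(s,a) = ρ(s)·π(a|s), the induced transition matrix P_π((s,a),(s',a')) = P_a(s,s')·π(a'|s'), and the occupancy measure λ_π := (1−γ) Σ_{t=0}^∞ γᵗ (P_πᵀ)ᵗ ρ̃ (the series converges absolutely). Then: (i) λ_π ∈ Δ(S×A), i.e., λ_π ≥ 0 and Σ_{s,a} λ_π(s,a) = 1; (ii) Σ_a (I − γP_aᵀ)(λ_π)_a = (1−γ)ρ; and (iii) for every r : S×A → ℝ, ⟨λ_π, r⟩ = (1−γ) Σ_{t=0}^∞ γᵗ ⟨(P_πᵀ)ᵗ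 ρ̃, r⟩. -/
open Finset

/-- The transpose of a row-stochastic matrix preserves the probability simplex, and so do its
powers. -/
theorem transpose_pow_mulVec_mem_stdSimplex {ι : Type*} [Fintype ι] [DecidableEq ι]
    {M : Matrix ι ι ℝ} (hM : ∀ i j, 0 ≤ M i j) (hM' : ∀ i, ∑ j, M i j = 1)
    {v : ι → ℝ} (hv : v ∈ stdSimplex ℝ ι) (t : ℕ) :
    (M.transpose ^ t).mulVec v ∈ stdSimplex ℝ ι := by
  induction t with
  | zero => simpa using hv
  | succ t ih =>
    rw [pow_succ', ← Matrix.mulVec_mulVec]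
    refine ⟨fun i => sum_nonneg fun j _ => mul_nonneg (hM j i) (ih.1 j), ?_⟩
    simp only [Matrix.mulVec, dotProduct, Matrix.transpose_apply]
    rw [sum_comm]
    simp only [← sum_mul, hM', one_mul]
    exact ih.2

/-- A discounted sequence of probability vectors is absolutely summable in each coordinate. -/
theorem summable_abs_discounted {ι : Type*} [Fintype ι] {γ : ℝ} (hγ0 : 0 ≤ γ) (hγ1 : γ < 1)
    {v : ℕ → ι → ℝ} (hv : ∀ t, v t ∈ stdSimplex ℝ ι) (i : ι) :
    Summable fun t : ℕ => |γ ^ t * v t i| := by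
  refine Summable.of_nonneg_of_le (fun t => abs_nonneg _) (fun t => ?_)
    (summable_geometric_of_lt_one hγ0 hγ1)
  have h1 : v t i ≤ 1 := (hv t).2 ▸ single_le_sum (fun j _ => (hv t).1 j) (mem_univ i)
  have h0 : 0 ≤ γ ^ t := pow_nonneg hγ0 t
  rw [abs_of_nonneg (mul_nonneg h0 ((hv t).1 i))]
  exact mul_le_of_le_one_right h0 h1

/-- Pairing with a fixed vector commutes with discounted summation. -/
theorem sum_tsum_discounted_mul {ι : Type*} [Fintype ι] {γ : ℝ} {v : ℕ → ι → ℝ}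
    (hs : ∀ i, Summable fun t : ℕ => γ ^ t * v t i) (r : ι → ℝ) :
    ∑ i, (∑' t : ℕ, γ ^ t * v t i) * r i = ∑' t : ℕ, γ ^ t * ∑ i, v t i * r i := by
  simp only [← tsum_mul_right]
  rw [← Summable.tsum_finsetSum fun i _ => (hs i).mul_right (r i)]
  simp only [mul_sum, mul_assoc]

/-- The discounted sum of the iterates of `N` on `v` solves `x = v + γ N x`. -/
theorem tsum_discounted_pow_mulVec {ι : Type*} [Fintype ι] [DecidableEq ι] {γ : ℝ}
    {N : Matrix ι ι ℝ} {v : ι → ℝ}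
    (hs : ∀ i, Summable fun t : ℕ => γ ^ t * (N ^ t).mulVec v i) (i : ι) :
    ∑' t : ℕ, γ ^ t * (N ^ t).mulVec v i =
      v i + γ * ∑ j, (∑' t : ℕ, γ ^ t * (N ^ t).mulVec v j) * N i j := by
  rw [sum_tsum_discounted_mul hs, (hs i).tsum_eq_zero_add, ← tsum_mul_left]
  congr 1
  · simp
  · refine tsum_congr fun t => ?_
    rw [pow_succ' N, ← Matrix.mulVec_mulVec, pow_succ', mul_assoc]
    simp only [Matrix.mulVec, dotProduct, mul_comm]

/-- Occupancy-measure correspondence: the occupancy measure of any stationary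
policy is a feasible point of the occupancy-measure LP whose objective value
equals the policy's discounted value. -/
theorem occupancy_measure_of_policy
    {S A : Type*} [Fintype S] [Fintype A] [Nonempty S] [Nonempty A]
    [DecidableEq S] [DecidableEq A]
    (P : A → S → S → ℝ)
    (hPnn : ∀ a s s', 0 ≤ P a s s') (hProw : ∀ a s, ∑ s', P a s s' = 1)
    (γ : ℝ) (hγ0 : 0 ≤ γ) (hγ1 : γ < 1)
    (ρ : S → ℝ) (hρnn : ∀ s, 0 ≤ ρ s) (hρsum : ∑ s, ρ s = 1)
    (π : S → A → ℝ) (hπnn : ∀ s a, 0 ≤ π s a) (hπsum : ∀ s, ∑ a, π s a = 1)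
    (ρt : S × A → ℝ) (hρt : ∀ p, ρt p = ρ p.1 * π p.1 p.2)
    (Pπ : Matrix (S × A) (S × A) ℝ)
    (hPπ : ∀ p q, Pπ p q = P p.2 p.1 q.1 * π q.1 q.2)
    (lamπ : S × A → ℝ)
    (hlam : ∀ p, lamπ p =
      (1 - γ) * ∑' t : ℕ, γ ^ t * (Pπ.transpose ^ t).mulVec ρt p) :
    (∀ p, Summable fun t : ℕ => |γ ^ t * (Pπ.transpose ^ t).mulVec ρt p|) ∧
    (∀ p, 0 ≤ lamπ p) ∧ (∑ p, lamπ p = 1) ∧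
    (∀ s, (∑ a, lamπ (s, a))
        - γ * ∑ a, ∑ s', P a s' s * lamπ (s', a) = (1 - γ) * ρ s) ∧
    (∀ r : S × A → ℝ, (∑ p, lamπ p * r p)
        = (1 - γ) * ∑' t : ℕ, γ ^ t * ∑ p, (Pπ.transpose ^ t).mulVec ρt p * r p) := by
  have hρt_mem : ρt ∈ stdSimplex ℝ (S × A) := by
    refine ⟨fun p => hρt p ▸ mul_nonneg (hρnn _) (hπnn _ _), ?_⟩
    simp only [hρt, Fintype.sum_prod_type, ← mul_sum, hπsum, mul_one, hρsum]
  have hPπ_nonneg : ∀ p q, 0 ≤ Pπ p q := fun p q =>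
    hPπ p q ▸ mul_nonneg (hPnn _ _ _) (hπnn _ _)
  have hPπ_sum : ∀ p, ∑ q, Pπ p q = 1 := fun p => by
    simp only [hPπ, Fintype.sum_prod_type, ← mul_sum, hπsum, mul_one, hProw]
  have hmem := transpose_pow_mulVec_mem_stdSimplex hPπ_nonneg hPπ_sum hρt_mem
  have habs := summable_abs_discounted hγ0 hγ1 hmem
  have hs := fun p => (habs p).of_abs
  have hvalue : ∀ r : S × A → ℝ, (∑ p, lamπ p * r p)
      = (1 - γ) * ∑' t : ℕ, γ ^ t * ∑ p, (Pπ.transpose ^ t).mulVec ρt p * r p := fun r => by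
    simp only [hlam, mul_assoc (1 - γ), ← mul_sum, sum_tsum_discounted_mul hs r]
  have hfix : ∀ p, lamπ p = (1 - γ) * ρt p + γ * ∑ q, lamπ q * Pπ q p := fun p => by
    simp only [hlam, mul_assoc (1 - γ), ← mul_sum]
    rw [tsum_discounted_pow_mulVec hs p]
    simp only [Matrix.transpose_apply]
    ring
  refine ⟨habs, fun p => ?_, ?_, fun s => ?_, hvalue⟩
  · rw [hlam]
    exact mul_nonneg (sub_nonneg.2 hγ1.le)
      (tsum_nonneg fun t => mul_nonneg (pow_nonneg hγ0 t) ((hmem t).1 p))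
  · have h := hvalue fun _ => 1
    simp only [mul_one, (hmem _).2, tsum_geometric_of_lt_one hγ0 hγ1] at h
    rw [h, mul_inv_cancel₀ (sub_pos.2 hγ1).ne']
  · have hflow : ∑ a, ∑ q, lamπ q * Pπ q (s, a) = ∑ a, ∑ s', P a s' s * lamπ (s', a) := by
      rw [sum_comm]
      simp only [hPπ, ← mul_sum, hπsum, mul_one]
      rw [Fintype.sum_prod_type_right]
      simp only [mul_comm]
    have hmarginal : ∑ a, ρt (s, a) = ρ s := by
      simp only [hρt, ← mul_sum, hπsum, mul_one]
    rw [sum_congr rfl fun a _ => hfix (s, a), sum_add_distrib, ← mul_sum, ← mul_sum, hflow,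
      hmarginal, add_sub_cancel_right]
end
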